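/- arXiv:2505.06757 — 2 statements merged into one kernel-verified Lean document; each statement's English description precedes it below -/
import Mathlib

section
/- Let G be a finitely generated Abelian group and let f : G → ℂ be a finitely supported function. If there exists a nonzero bounded function a : G → ℂ with f * a = 0 (convolution), then there exists a character χ : G → ℂ (a group homomorphism into the unit circle) such that the Fourier coefficient ∑_{x ∈ G} f(x) · conj(χ(x)) equals 0. -/
/-- If a finite linear combination of a contractive representation of an abelian group in a complex
Banach algebra is not invertible, then it is annihilated by some unitary character. -/
theorem exists_addChar_sum_eq_zero_of_not_isUnit {G A : Type*} [AddCommGroup G] [NormedRing A]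
    [NormedAlgebra ℂ A] [CompleteSpace A] (T : AddChar G A) (hT : ∀ x, ‖T x‖ ≤ 1)
    (f : G → ℂ) (s : Finset G) (h : ¬ IsUnit (∑ y ∈ s, f y • T y)) :
    ∃ χ : AddChar G ℂ, (∀ x, ‖χ x‖ = 1) ∧ ∑ y ∈ s, f y * χ y = 0 := by
  let B : Subalgebra ℂ A := (Algebra.adjoin ℂ (Set.range T)).topologicalClosure
  have hcomm : ∀ x ∈ Set.range T, ∀ y ∈ Set.range T, x * y = y * x := by
    rintro _ ⟨x, rfl⟩ _ ⟨y, rfl⟩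
    rw [← AddChar.map_add_eq_mul, add_comm, AddChar.map_add_eq_mul]
  have hmul : ∀ x y : B, x * y = y * x :=
    (Subalgebra.commRingTopologicalClosure (Algebra.adjoin ℂ (Set.range T))
      (Algebra.isMulCommutative_adjoin ℂ hcomm).is_comm.comm).mul_comm
  let : NormedCommRing B := { (inferInstance : NormedRing B) with mul_comm := hmul }
  let : NormedAlgebra ℂ B := B.toNormedAlgebra
  have : CompleteSpace B :=
    (Subalgebra.isClosed_topologicalClosure (Algebra.adjoin ℂ (Set.range T))).completeSpace_coe
  have hmem : ∀ x, T x ∈ B := fun x =>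
    Subalgebra.le_topologicalClosure _ (Algebra.subset_adjoin ⟨x, rfl⟩)
  let S : G → B := fun x => ⟨T x, hmem x⟩
  have hnot : ¬ IsUnit (∑ y ∈ s, f y • S y) := by
    intro hu
    apply h
    have := hu.map B.val
    simpa [S] using this
  obtain ⟨φ, hφ⟩ := WeakDual.CharacterSpace.exists_apply_eq_zero hnot
  let χ : AddChar G ℂ :=
    { toFun := fun x => φ (S x)
      map_zero_eq_one' := by
        have : S 0 = 1 := Subtype.ext (AddChar.map_zero_eq_one T)
        rw [this, map_one]
      map_add_eq_mul' := fun x y => by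
        have : S (x + y) = S x * S y := Subtype.ext (AddChar.map_add_eq_mul T x y)
        rw [this, map_mul] }
  have hone : ‖(1 : B)‖ ≤ 1 := (congrArg norm (AddChar.map_zero_eq_one T)).symm.trans_le (hT 0)
  have hle : ∀ x, ‖χ x‖ ≤ 1 := fun x =>
    (spectrum.norm_le_norm_mul_of_mem
      (WeakDual.CharacterSpace.apply_mem_spectrum φ (S x))).trans
      (mul_le_one₀ (hT x) (norm_nonneg _) hone)
  refine ⟨χ, fun x => le_antisymm (hle x) ?_, ?_⟩
  · have h1 : ‖χ x‖ * ‖χ (-x)‖ = 1 := by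
      rw [← norm_mul, ← AddChar.map_add_eq_mul]; simp
    nlinarith [hle x, hle (-x), norm_nonneg (χ x), norm_nonneg (χ (-x))]
  · simpa [χ] using hφ

/-- Translation operators acting on the bounded functions on a discrete abelian group. -/
noncomputable def translationAddChar (G : Type*) [AddCommGroup G] [TopologicalSpace G]
    [DiscreteTopology G] :
    AddChar G (BoundedContinuousFunction G ℂ →L[ℂ] BoundedContinuousFunction G ℂ) where
  toFun y := LinearMap.mkContinuous
    { toFun := fun b => b.compContinuous ⟨fun x => x - y, continuous_of_discreteTopology⟩
      map_add' := fun _ _ => rfl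
      map_smul' := fun _ _ => rfl } 1 fun b => by
        rw [one_mul]
        exact (BoundedContinuousFunction.norm_le (norm_nonneg b)).2 fun x =>
          b.norm_coe_le_norm (x - y)
  map_zero_eq_one' := by
    ext b x
    simp
  map_add_eq_mul' y z := by
    ext b x
    exact congrArg b (sub_add_eq_sub_sub x y z)

theorem translationAddChar_apply_apply {G : Type*} [AddCommGroup G] [TopologicalSpace G]
    [DiscreteTopology G] (y : G) (b : BoundedContinuousFunction G ℂ) (x : G) :
    translationAddChar G y b x = b (x - y) :=
  rfl

theorem norm_translationAddChar_le {G : Type*} [AddCommGroup G] [TopologicalSpace G]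
    [DiscreteTopology G] (y : G) : ‖translationAddChar G y‖ ≤ 1 :=
  ContinuousLinearMap.opNorm_le_bound _ zero_le_one fun b => by
    rw [one_mul]
    exact (BoundedContinuousFunction.norm_le (norm_nonneg b)).2 fun x =>
      b.norm_coe_le_norm (x - y)

/-- Let `G` be a finitely generated Abelian group and `f : G → ℂ`
finitely supported.  If there is a nonzero bounded `a : G → ℂ` with `f * a = 0`,
then there is a character `χ : G → ℂ` (homomorphism into the unit circle) whose
Fourier coefficient `∑ₓ f x * conj (χ x)` vanishes. -/
theorem stmt0 (G : Type*) [AddCommGroup G] [AddGroup.FG G]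
    (f : G → ℂ) (hf : (Function.support f).Finite)
    (a : G → ℂ) (ha : a ≠ 0) (hbdd : ∃ C : ℝ, ∀ x, ‖a x‖ ≤ C)
    (hconv : ∀ x : G, ∑ᶠ y : G, f y * a (x - y) = 0) :
    ∃ χ : AddChar G ℂ, (∀ x, ‖χ x‖ = 1) ∧
      ∑ᶠ x : G, f x * (starRingEnd ℂ) (χ x) = 0 := by
  let : TopologicalSpace G := ⊥
  have : DiscreteTopology G := ⟨rfl⟩
  obtain ⟨C, hC⟩ := hbdd
  have hsum (g : G → ℂ) : ∑ᶠ y, f y * g y = ∑ y ∈ hf.toFinset, f y * g y :=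
    finsum_eq_sum_of_support_subset _ fun y hy => by
      simpa using left_ne_zero_of_mul hy
  let b : BoundedContinuousFunction G ℂ :=
    BoundedContinuousFunction.ofNormedAddCommGroup a continuous_of_discreteTopology C hC
  have hker : (∑ y ∈ hf.toFinset, f y • translationAddChar G y) b = 0 := by
    ext x
    have h := hconv x
    rw [hsum fun y => a (x - y)] at h
    simpa [translationAddChar_apply_apply, b] using h
  have hnot : ¬ IsUnit (∑ y ∈ hf.toFinset, f y • translationAddChar G y) := by
    rintro ⟨u, hu⟩
    have hb : b = 0 := by
      have h := congrArg (fun L => L b) u.inv_mul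
      simpa [hu, hker] using h.symm
    exact ha (funext fun x => DFunLike.congr_fun hb x)
  obtain ⟨χ, hχ, hχf⟩ := exists_addChar_sum_eq_zero_of_not_isUnit
    (A := BoundedContinuousFunction G ℂ →L[ℂ] BoundedContinuousFunction G ℂ) (translationAddChar G)
    norm_translationAddChar_le f hf.toFinset hnot
  refine ⟨χ⁻¹, fun x => ?_, ?_⟩
  · rw [AddChar.inv_apply, hχ]
  · rw [hsum fun y => (starRingEnd ℂ) (χ⁻¹ y), ← hχf]
    refine Finset.sum_congr rfl fun y _ => ?_
    rw [AddChar.inv_apply', Complex.inv_eq_conj (hχ y), Complex.conj_conj]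
end

section
/- Let f := 3·𝟙_{{-1,1}} − 2·𝟙_{{0}} : ℤ → ℤ. Then the only bounded function a : ℤ → ℤ satisfying f * a = 0 is the zero function. -/
/-- An integer sequence with `2 a(x) = 3 (a(x + 1) + a(x - 1))` is divisible by every power of `3`. -/
lemma three_pow_dvd_of_recurrence {a : ℤ → ℤ}
    (h : ∀ x, 2 * a x = 3 * (a (x + 1) + a (x - 1))) (k : ℕ) (x : ℤ) : 3 ^ k ∣ a x := by
  induction k generalizing x with
  | zero => simp
  | succ k ih =>
    have hcop : IsCoprime ((3 : ℤ) ^ (k + 1)) 2 := IsCoprime.pow_left ⟨1, -1, by norm_num⟩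
    refine hcop.dvd_of_dvd_mul_left ?_
    rw [h x, pow_succ']
    exact mul_dvd_mul_left 3 (dvd_add (ih _) (ih _))

lemma eq_zero_of_three_pow_dvd {n : ℤ} (h : ∀ k : ℕ, 3 ^ k ∣ n) : n = 0 := by
  refine Int.eq_zero_of_abs_lt_dvd (h n.natAbs) ?_
  rw [Int.abs_eq_natAbs]
  exact_mod_cast Nat.lt_pow_self (by norm_num : 1 < 3)

open Classical in
/-- For `f = 3·𝟙_{{-1,1}} - 2·𝟙_{{0}} : ℤ → ℤ`, the only bounded
`a : ℤ → ℤ` with `f * a = 0` is the zero function. -/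
theorem stmt3
    (f : ℤ → ℤ)
    (hfdef : f = fun x => 3 * (if x = -1 ∨ x = 1 then 1 else 0)
      - 2 * (if x = 0 then 1 else 0))
    (a : ℤ → ℤ) (hbdd : ∃ C : ℤ, ∀ x, |a x| ≤ C)
    (hconv : ∀ x : ℤ, ∑ᶠ y : ℤ, f y * a (x - y) = 0) :
    a = 0 := by
  have hrec : ∀ x, 2 * a x = 3 * (a (x + 1) + a (x - 1)) := by
    intro x
    have hx := hconv x
    rw [finsum_eq_sum_of_support_subset (s := {-1, 0, 1})] at hx
    · simp [hfdef] at hx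
      linarith
    · intro y hy
      contrapose! hy
      simp only [Finset.coe_insert, Finset.coe_singleton, Set.mem_insert_iff,
        Set.mem_singleton_iff, not_or] at hy
      simp [hfdef, hy]
  funext x
  exact eq_zero_of_three_pow_dvd fun k => three_pow_dvd_of_recurrence hrec k x
end
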